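/- For every N ∈ ℕ, every f ∈ E_N, every 0 < δ ≤ 1 and every multi-index β ∈ ℕⁿ, the Bernstein-type estimate ‖∂_x^β f‖_{L²(ℝⁿ)} ≤ e^{e/(2δ²)} · (2δ)^{|β|} · |β|! · e^{δ^{−1}√N} · ‖f‖_{L²(ℝⁿ)} holds, where ∂_x^β = ∂_{x₁}^{β₁} ⋯ ∂_{x_n}^{β_n}. -/

import Mathlib

open MeasureTheory

noncomputable section

/-- The one-dimensional Hermite functions
`φ_k(x) = ((-1)^k / √(2^k k! √π)) e^{x²/2} (d/dx)^k e^{-x²}`. -/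
def hermiteFn (k : ℕ) (x : ℝ) : ℝ :=
  ((-1 : ℝ) ^ k / Real.sqrt (2 ^ k * Nat.factorial k * Real.sqrt Real.pi)) *
    Real.exp (x ^ 2 / 2) * iteratedDeriv k (fun y => Real.exp (-(y ^ 2))) x

/-- The `n`-dimensional Hermite functions `Φ_α(x) = ∏_j φ_{α_j}(x_j)`, viewed as
complex-valued functions. -/
def hermitePhi {n : ℕ} (α : Fin n → ℕ) (x : EuclideanSpace ℝ (Fin n)) : ℂ :=
  ∏ j, (hermiteFn (α j) (x j) : ℂ)

/-- `E_N`, the span of the Hermite functions `Φ_α` with `|α| ≤ N`. -/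
def hermiteSpan (n N : ℕ) : Submodule ℂ (EuclideanSpace ℝ (Fin n) → ℂ) :=
  Submodule.span ℂ {f | ∃ α : Fin n → ℕ, (∑ j, α j) ≤ N ∧ f = hermitePhi α}

end
noncomputable section

/-- The partial derivative `∂_{x_j}` of a function on `ℝⁿ`. -/
def partialDerivE {n : ℕ} (j : Fin n) (f : EuclideanSpace ℝ (Fin n) → ℂ) :
    EuclideanSpace ℝ (Fin n) → ℂ :=
  fun x => fderiv ℝ f x (EuclideanSpace.single j 1)

/-- The iterated partial derivative `∂_x^β = ∂_{x_1}^{β_1} ⋯ ∂_{x_n}^{β_n}`. -/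
def multiDerivE {n : ℕ} (β : Fin n → ℕ) (f : EuclideanSpace ℝ (Fin n) → ℂ) :
    EuclideanSpace ℝ (Fin n) → ℂ :=
  (List.finRange n).foldr (fun j g => (partialDerivE j)^[β j] g) f

end

/-- The physicist Hermite polynomials. -/
noncomputable def hbPoly : ℕ → Polynomial ℝ
  | 0 => 1
  | k + 1 => 2 * Polynomial.X * hbPoly k - Polynomial.derivative (hbPoly k)

/-- Normalization constants. -/
noncomputable def hbC (k : ℕ) : ℝ := (Real.sqrt (2 ^ k * Nat.factorial k * Real.sqrt Real.pi))⁻¹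

lemma hb_hasDerivAt_gauss (x : ℝ) :
    HasDerivAt (fun y : ℝ => Real.exp (-(y ^ 2))) (-(2 * x) * Real.exp (-(x ^ 2))) x := by
  have := ((hasDerivAt_pow 2 x).fun_neg).exp
  convert this using 1
  simp
  ring

lemma hb_iteratedDeriv (k : ℕ) :
    iteratedDeriv k (fun y : ℝ => Real.exp (-(y ^ 2))) =
      fun x => (-1) ^ k * (hbPoly k).eval x * Real.exp (-(x ^ 2)) := by
  induction k with
  | zero => simp [hbPoly]
  | succ k ih =>
    rw [iteratedDeriv_succ, ih]
    funext x
    have h1 := (((hbPoly k).hasDerivAt x).const_mul ((-1 : ℝ) ^ k)).mul (hb_hasDerivAt_gauss x)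
    refine (h1.deriv).trans ?_
    simp [hbPoly, pow_succ]
    ring

lemma hb_hermiteFn_eq (k : ℕ) (x : ℝ) :
    hermiteFn k x = hbC k * ((hbPoly k).eval x * Real.exp (-(x ^ 2 / 2))) := by
  unfold hermiteFn hbC
  rw [hb_iteratedDeriv]
  have h1 : ((-1 : ℝ) ^ k) * (-1) ^ k = 1 := by rw [← mul_pow]; simp
  have h2 : Real.exp (x ^ 2 / 2) * Real.exp (-(x ^ 2)) = Real.exp (-(x ^ 2 / 2)) := by
    rw [← Real.exp_add]; congr 1; ring
  rw [← h2]
  linear_combination (Real.sqrt (2 ^ k * Nat.factorial k * Real.sqrt Real.pi))⁻¹ *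
    Real.exp (x ^ 2 / 2) * (hbPoly k).eval x * Real.exp (-(x ^ 2)) * h1

lemma hb_deriv_poly (k : ℕ) :
    Polynomial.derivative (hbPoly (k + 1)) = (2 * (k + 1) : Polynomial ℝ) * hbPoly k := by
  induction k with
  | zero => simp [hbPoly]
  | succ k ih =>
    rw [hbPoly]
    simp only [map_sub, Polynomial.derivative_mul, ih]
    simp only [hbPoly]
    simp
    ring

lemma hb_integrable (P : Polynomial ℝ) :
    Integrable (fun x : ℝ => P.eval x * Real.exp (-(x ^ 2))) := by
  induction P using Polynomial.induction_on' with
  | add p q hp hq => simpa [add_mul] using! hp.add hq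
  | monomial m a =>
    have := (integrable_rpow_mul_exp_neg_mul_sq (b := 1) one_pos (s := (m : ℝ))
      (by have : (0 : ℝ) ≤ m := by positivity
          linarith)).const_mul a
    refine this.congr (Filter.Eventually.of_forall fun x => ?_)
    simp [mul_assoc]

lemma hb_ibp (k : ℕ) (Q : Polynomial ℝ) :
    ∫ x : ℝ, (hbPoly (k + 1) * Q).eval x * Real.exp (-(x ^ 2)) =
      ∫ x : ℝ, (hbPoly k * Polynomial.derivative Q).eval x * Real.exp (-(x ^ 2)) := by
  have h := integral_eq_zero_of_hasDerivAt_of_integrable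
    (f := fun x : ℝ => (hbPoly k * Q).eval x * Real.exp (-(x ^ 2)))
    (f' := fun x : ℝ => (hbPoly k * Polynomial.derivative Q).eval x * Real.exp (-(x ^ 2)) -
      (hbPoly (k + 1) * Q).eval x * Real.exp (-(x ^ 2))) ?_ ?_ ?_
  · rw [integral_sub (hb_integrable _) (hb_integrable _)] at h
    linarith
  · intro x
    refine (((hbPoly k * Q).hasDerivAt x).mul (hb_hasDerivAt_gauss x)).congr_deriv ?_
    simp [hbPoly]
    ring
  · exact (hb_integrable _).sub (hb_integrable _)
  · exact hb_integrable _

lemma hb_orth (k l : ℕ) :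
    ∫ x : ℝ, (hbPoly k * hbPoly l).eval x * Real.exp (-(x ^ 2)) =
      if k = l then 2 ^ k * (Nat.factorial k : ℝ) * Real.sqrt Real.pi else 0 := by
  induction k generalizing l with
  | zero =>
    cases l with
    | zero => simpa [hbPoly] using integral_gaussian 1
    | succ l => rw [mul_comm, hb_ibp]; simp [hbPoly]
  | succ k ih =>
    rw [hb_ibp]
    cases l with
    | zero => simp [hbPoly]
    | succ l =>
      rw [hb_deriv_poly]
      have : ∀ x : ℝ, (hbPoly k * ((2 * (l + 1) : Polynomial ℝ) * hbPoly l)).eval x *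
          Real.exp (-(x ^ 2)) =
          (2 * (l + 1)) * ((hbPoly k * hbPoly l).eval x * Real.exp (-(x ^ 2))) := by
        intro x; simp; ring
      simp_rw [this]
      rw [integral_const_mul, ih]
      by_cases h : k = l
      · subst h
        simp [Nat.factorial_succ, pow_succ]
        ring
      · simp [h]

lemma hb_mul_eq (k l : ℕ) (x : ℝ) : hermiteFn k x * hermiteFn l x =
    (hbC k * hbC l) * ((hbPoly k * hbPoly l).eval x * Real.exp (-(x ^ 2))) := by
  rw [hb_hermiteFn_eq, hb_hermiteFn_eq]
  have h2 : Real.exp (-(x ^ 2)) = Real.exp (-(x ^ 2 / 2)) * Real.exp (-(x ^ 2 / 2)) := by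
    rw [← Real.exp_add]; congr 1; ring
  rw [h2]
  simp
  ring

lemma hb_fn_integrable (k l : ℕ) : Integrable (fun x => hermiteFn k x * hermiteFn l x) := by
  simp_rw [hb_mul_eq]
  exact (hb_integrable _).const_mul _

lemma hb_fn_orth (k l : ℕ) :
    ∫ x, hermiteFn k x * hermiteFn l x = if k = l then 1 else 0 := by
  simp_rw [hb_mul_eq]
  rw [integral_const_mul, hb_orth]
  by_cases h : k = l
  · subst h
    have hp : 0 < 2 ^ k * (Nat.factorial k : ℝ) * Real.sqrt Real.pi := by positivity
    simp only [if_true]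
    unfold hbC
    rw [← mul_inv, Real.mul_self_sqrt hp.le]
    exact inv_mul_cancel₀ hp.ne'
  · simp [h]

lemma hbC_succ (k : ℕ) : hbC k = Real.sqrt (2 * (k + 1)) * hbC (k + 1) := by
  unfold hbC
  have : (2 : ℝ) ^ (k + 1) * (Nat.factorial (k + 1) : ℝ) * Real.sqrt Real.pi =
    (2 * (k + 1)) * (2 ^ k * (Nat.factorial k : ℝ) * Real.sqrt Real.pi) := by
    rw [Nat.factorial_succ]; push_cast; ring
  rw [this, Real.sqrt_mul (x := 2 * ((k : ℝ) + 1)) (by positivity), mul_inv]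
  have : Real.sqrt (2 * ((k : ℝ) + 1)) ≠ 0 := by positivity
  rw [← mul_assoc, mul_inv_cancel₀ this, one_mul]

lemma hb_fn_hasDerivAt (k : ℕ) (x : ℝ) :
    HasDerivAt (hermiteFn k) (Real.sqrt (k / 2) * hermiteFn (k - 1) x -
      Real.sqrt ((k + 1) / 2) * hermiteFn (k + 1) x) x := by
  have hfun : hermiteFn k = fun x => hbC k * ((hbPoly k).eval x * Real.exp (-(x ^ 2 / 2))) :=
    funext (hb_hermiteFn_eq k)
  have hg : HasDerivAt (fun y : ℝ => Real.exp (-(y ^ 2 / 2))) (-x * Real.exp (-(x ^ 2 / 2))) x := by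
    have := (((hasDerivAt_pow 2 x).div_const 2).fun_neg).exp
    convert this using 1
    simp
    ring
  rw [hfun]
  refine ((((hbPoly k).hasDerivAt x).mul hg).const_mul (hbC k)).congr_deriv ?_
  simp only [hb_hermiteFn_eq]
  have e1 : Real.sqrt (((k : ℝ) + 1) / 2) * hbC (k + 1) = hbC k / 2 := by
    rw [hbC_succ k]
    have : Real.sqrt (2 * ((k : ℝ) + 1)) = 2 * Real.sqrt (((k : ℝ) + 1) / 2) := by
      rw [show 2 * ((k : ℝ) + 1) = 2 ^ 2 * (((k : ℝ) + 1) / 2) by ring,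
        Real.sqrt_mul (by positivity), Real.sqrt_sq (by norm_num)]
    rw [this]; ring
  have e2 : Real.sqrt ((k : ℝ) / 2) * hbC (k - 1) * (hbPoly (k - 1)).eval x =
      hbC k * (Polynomial.derivative (hbPoly k)).eval x / 2 := by
    cases k with
    | zero => simp [hbPoly]
    | succ k =>
      rw [hb_deriv_poly]
      simp only [Nat.add_sub_cancel]
      rw [hbC_succ k]
      have : Real.sqrt ((((k + 1 : ℕ) : ℝ)) / 2) * Real.sqrt (2 * ((k : ℝ) + 1)) = k + 1 := by
        rw [← Real.sqrt_mul (by positivity)]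
        push_cast
        rw [show ((k : ℝ) + 1) / 2 * (2 * (k + 1)) = (k + 1) ^ 2 by ring,
          Real.sqrt_sq (by positivity)]
      simp
      simp at this
      linear_combination hbC (k + 1) * (hbPoly k).eval x * this
  have e3 : (hbPoly (k + 1)).eval x =
      2 * x * (hbPoly k).eval x - (Polynomial.derivative (hbPoly k)).eval x := by
    simp [hbPoly]
  rw [e3]
  linear_combination (-Real.exp (-(x ^ 2 / 2))) * e2 + Real.exp (-(x ^ 2 / 2)) *
    (2 * x * (hbPoly k).eval x - (Polynomial.derivative (hbPoly k)).eval x) * e1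

lemma hb_phi_mul {n : ℕ} (α β : Fin n → ℕ) (x : EuclideanSpace ℝ (Fin n)) :
    hermitePhi α x * hermitePhi β x =
      ∏ j, (((hermiteFn (α j) (x j) * hermiteFn (β j) (x j) : ℝ)) : ℂ) := by
  simp [hermitePhi, Finset.prod_mul_distrib]

lemma hb_phi_integrable {n : ℕ} (α β : Fin n → ℕ) :
    Integrable (fun x : EuclideanSpace ℝ (Fin n) => hermitePhi α x * hermitePhi β x) := by
  simp_rw [hb_phi_mul]
  rw [← (PiLp.volume_preserving_toLp (Fin n)).integrable_comp_emb
    (MeasurableEquiv.toLp 2 _).measurableEmbedding]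
  exact Integrable.fintype_prod (f := fun j (t : ℝ) =>
    ((hermiteFn (α j) t * hermiteFn (β j) t : ℝ) : ℂ)) (fun j => (hb_fn_integrable _ _).ofReal)

lemma hb_phi_orth {n : ℕ} (α β : Fin n → ℕ) :
    ∫ x : EuclideanSpace ℝ (Fin n), hermitePhi α x * hermitePhi β x =
      if α = β then 1 else 0 := by
  simp_rw [hb_phi_mul]
  rw [← (PiLp.volume_preserving_toLp (Fin n)).integral_comp
    (MeasurableEquiv.toLp 2 _).measurableEmbedding]
  have h := integral_fintype_prod_volume_eq_prod (ι := Fin n) (E := fun _ => ℝ)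
    (fun j (t : ℝ) => ((hermiteFn (α j) t * hermiteFn (β j) t : ℝ) : ℂ))
  refine h.trans ?_
  have horth : ∀ j, ∫ t, ((hermiteFn (α j) t * hermiteFn (β j) t : ℝ) : ℂ) =
      if α j = β j then 1 else 0 := by
    intro j
    rw [integral_complex_ofReal, hb_fn_orth]
    split_ifs <;> simp
  simp_rw [horth]
  by_cases hab : α = β
  · simp [hab]
  · obtain ⟨j, hj⟩ := Function.ne_iff.mp hab
    rw [if_neg hab]
    exact Finset.prod_eq_zero (Finset.mem_univ j) (by simp [hj])

lemma hb_phi_conj {n : ℕ} (α : Fin n → ℕ) (x : EuclideanSpace ℝ (Fin n)) :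
    (starRingEnd ℂ) (hermitePhi α x) = hermitePhi α x := by
  simp [hermitePhi]

lemma hb_expand {ι : Type*} {n : ℕ} (s : Finset ι) (c : ι → ℂ) (g : ι → Fin n → ℕ)
    (x : EuclideanSpace ℝ (Fin n)) :
    ((‖∑ i ∈ s, c i * hermitePhi (g i) x‖ ^ 2 : ℝ) : ℂ) =
      ∑ i ∈ s, ∑ k ∈ s, (starRingEnd ℂ (c i) * c k) *
        (hermitePhi (g i) x * hermitePhi (g k) x) := by
  push_cast
  rw [← Complex.conj_mul', map_sum, Finset.sum_mul_sum]
  refine Finset.sum_congr rfl fun i _ => Finset.sum_congr rfl fun k _ => ?_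
  rw [map_mul, hb_phi_conj]
  ring

lemma hb_sum_integrable {ι : Type*} {n : ℕ} (s : Finset ι) (c : ι → ℂ) (g : ι → Fin n → ℕ) :
    Integrable (fun x : EuclideanSpace ℝ (Fin n) =>
      ‖∑ i ∈ s, c i * hermitePhi (g i) x‖ ^ 2) := by
  have h : Integrable (fun x : EuclideanSpace ℝ (Fin n) =>
      ((‖∑ i ∈ s, c i * hermitePhi (g i) x‖ ^ 2 : ℝ) : ℂ)) := by
    simp_rw [hb_expand]
    exact integrable_finsetSum _ fun i _ => integrable_finsetSum _ fun k _ =>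
      (hb_phi_integrable _ _).const_mul _
  exact h.re

lemma hb_parseval {ι : Type*} {n : ℕ} (s : Finset ι) (c : ι → ℂ) (g : ι → Fin n → ℕ)
    (hg : Set.InjOn g s) :
    ∫ x : EuclideanSpace ℝ (Fin n), ‖∑ i ∈ s, c i * hermitePhi (g i) x‖ ^ 2 =
      ∑ i ∈ s, ‖c i‖ ^ 2 := by
  have h : ((∫ x : EuclideanSpace ℝ (Fin n), ‖∑ i ∈ s, c i * hermitePhi (g i) x‖ ^ 2 : ℝ) : ℂ) =
      ((∑ i ∈ s, ‖c i‖ ^ 2 : ℝ) : ℂ) := by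
    rw [← integral_complex_ofReal]
    simp_rw [hb_expand]
    rw [integral_finsetSum _ fun i _ => integrable_finsetSum _ fun k _ =>
      (hb_phi_integrable _ _).const_mul _]
    push_cast
    refine Finset.sum_congr rfl fun i hi => ?_
    rw [integral_finsetSum _ fun k _ => (hb_phi_integrable _ _).const_mul _]
    simp_rw [integral_const_mul, hb_phi_orth]
    rw [Finset.sum_eq_single i]
    · simp [Complex.conj_mul']
    · intro k hk hki
      rw [if_neg (fun h => hki (hg hi hk h).symm), mul_zero]
    · intro h; exact absurd hi h
  exact_mod_cast h

lemma hb_mem_span {n N : ℕ} {f : EuclideanSpace ℝ (Fin n) → ℂ} (hf : f ∈ hermiteSpan n N) :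
    ∃ (s : Finset (Fin n → ℕ)) (c : (Fin n → ℕ) → ℂ), (∀ α ∈ s, ∑ j, α j ≤ N) ∧
      f = fun x => ∑ α ∈ s, c α * hermitePhi α x := by
  have he : {f | ∃ α : Fin n → ℕ, (∑ j, α j) ≤ N ∧ f = hermitePhi α} =
      hermitePhi '' {α : Fin n → ℕ | ∑ j, α j ≤ N} := by
    ext g
    constructor
    · rintro ⟨α, h, rfl⟩; exact ⟨α, h, rfl⟩
    · rintro ⟨α, h, rfl⟩; exact ⟨α, h, rfl⟩
  unfold hermiteSpan at hf
  rw [he, Finsupp.mem_span_image_iff_linearCombination] at hf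
  obtain ⟨l, hl, rfl⟩ := hf
  refine ⟨l.support, l, fun α hα => hl hα, ?_⟩
  funext x
  simp [Finsupp.linearCombination_apply, Finsupp.sum]

lemma hb_phi_mem {n N : ℕ} (α : Fin n → ℕ) (h : ∑ j, α j ≤ N) : hermitePhi α ∈ hermiteSpan n N :=
  Submodule.subset_span ⟨α, h, rfl⟩

lemma hb_phi_differentiable {n : ℕ} (α : Fin n → ℕ) : Differentiable ℝ (hermitePhi α) := by
  unfold hermitePhi
  have h : ∀ j, Differentiable ℝ
      (fun x : EuclideanSpace ℝ (Fin n) => ((hermiteFn (α j) (x j) : ℝ) : ℂ)) := by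
    intro j
    have h1 : Differentiable ℝ (hermiteFn (α j)) :=
      fun x => (hb_fn_hasDerivAt (α j) x).differentiableAt
    have h2 : Differentiable ℝ (fun x : EuclideanSpace ℝ (Fin n) => x j) := by fun_prop
    exact Complex.ofRealCLM.differentiable.comp (h1.comp h2)
  fun_prop

lemma hb_phi_update {n : ℕ} (α : Fin n → ℕ) (j : Fin n) (k : ℕ) (x : EuclideanSpace ℝ (Fin n)) :
    hermitePhi (Function.update α j k) x =
      (hermiteFn k (x j) : ℂ) * ∏ i ∈ Finset.univ.erase j, (hermiteFn (α i) (x i) : ℂ) := by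
  unfold hermitePhi
  rw [← Finset.mul_prod_erase _ _ (Finset.mem_univ j)]
  congr 1
  · simp
  · refine Finset.prod_congr rfl fun i hi => ?_
    rw [Function.update_of_ne (Finset.ne_of_mem_erase hi)]

lemma hb_phi_partial {n : ℕ} (α : Fin n → ℕ) (j : Fin n) (x : EuclideanSpace ℝ (Fin n)) :
    partialDerivE j (hermitePhi α) x =
      (Real.sqrt (α j / 2) : ℂ) * hermitePhi (Function.update α j (α j - 1)) x -
      (Real.sqrt ((α j + 1) / 2) : ℂ) * hermitePhi (Function.update α j (α j + 1)) x := by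
  unfold partialDerivE
  rw [← (hb_phi_differentiable α x).lineDeriv_eq_fderiv, lineDeriv]
  have hfun : (fun t : ℝ => hermitePhi α (x + t • EuclideanSpace.single j (1 : ℝ))) =
      fun t : ℝ => (hermiteFn (α j) (x j + t) : ℂ) *
        ∏ i ∈ Finset.univ.erase j, (hermiteFn (α i) (x i) : ℂ) := by
    funext t
    unfold hermitePhi
    rw [← Finset.mul_prod_erase _ _ (Finset.mem_univ j)]
    congr 1
    · simp
    · refine Finset.prod_congr rfl fun i hi => ?_
      simp [Finset.ne_of_mem_erase hi]
  rw [hfun]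
  have h0 : HasDerivAt (hermiteFn (α j)) (Real.sqrt (α j / 2) * hermiteFn (α j - 1) (x j) -
      Real.sqrt ((α j + 1) / 2) * hermiteFn (α j + 1) (x j)) (x j + 0) := by
    simpa using hb_fn_hasDerivAt (α j) (x j)
  have h1 := (HasDerivAt.comp_const_add (x j) 0 h0).ofReal_comp.mul_const
    (∏ i ∈ Finset.univ.erase j, (hermiteFn (α i) (x i) : ℂ))
  rw [h1.deriv, hb_phi_update, hb_phi_update]
  push_cast
  ring

lemma hb_partial_sum {n : ℕ} (s : Finset (Fin n → ℕ)) (c : (Fin n → ℕ) → ℂ) (j : Fin n)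
    (x : EuclideanSpace ℝ (Fin n)) :
    partialDerivE j (fun x => ∑ α ∈ s, c α * hermitePhi α x) x =
      ∑ α ∈ s, c α * partialDerivE j (hermitePhi α) x := by
  unfold partialDerivE
  have : HasFDerivAt (fun x => ∑ α ∈ s, c α * hermitePhi α x)
      (∑ α ∈ s, c α • fderiv ℝ (hermitePhi α) x) x :=
    HasFDerivAt.fun_sum fun α _ => ((hb_phi_differentiable α x).hasFDerivAt).const_mul (c α)
  rw [this.fderiv]
  simp

lemma hb_step {n N : ℕ} {f : EuclideanSpace ℝ (Fin n) → ℂ} (hf : f ∈ hermiteSpan n N)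
    (j : Fin n) : partialDerivE j f ∈ hermiteSpan n (N + 1) ∧
      ∫ x, ‖partialDerivE j f x‖ ^ 2 ≤ (2 * N + 2) * ∫ x, ‖f x‖ ^ 2 := by
  classical
  obtain ⟨s, c, hs, rfl⟩ := hb_mem_span hf
  have hupd : ∀ (α : Fin n → ℕ) (k : ℕ), ∑ i, Function.update α j k i + α j = (∑ i, α i) + k := by
    intro α k
    rw [← Finset.add_sum_erase _ _ (Finset.mem_univ j),
      ← Finset.add_sum_erase Finset.univ α (Finset.mem_univ j)]
    rw [Finset.sum_congr rfl (g := α) fun i hi =>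
      Function.update_of_ne (Finset.ne_of_mem_erase hi) _ _]
    simp
    ring
  have hle : ∀ α ∈ s, (α j : ℝ) ≤ N := by
    intro α hα
    have h1 : α j ≤ ∑ i, α i := Finset.single_le_sum (fun i _ => Nat.zero_le _) (Finset.mem_univ j)
    exact_mod_cast h1.trans (hs α hα)
  set L : EuclideanSpace ℝ (Fin n) → ℂ := fun x => ∑ α ∈ s with 1 ≤ α j,
    (c α * (Real.sqrt (α j / 2) : ℂ)) * hermitePhi (Function.update α j (α j - 1)) x with hL
  set R : EuclideanSpace ℝ (Fin n) → ℂ := fun x => ∑ α ∈ s,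
    (c α * (Real.sqrt ((α j + 1) / 2) : ℂ)) * hermitePhi (Function.update α j (α j + 1)) x with hR
  have hD : partialDerivE j (fun x => ∑ α ∈ s, c α * hermitePhi α x) = L - R := by
    funext x
    rw [hb_partial_sum, Pi.sub_apply, hL, hR]
    simp only
    rw [Finset.sum_filter, ← Finset.sum_sub_distrib]
    refine Finset.sum_congr rfl fun α _ => ?_
    rw [hb_phi_partial]
    by_cases h : 1 ≤ α j
    · rw [if_pos h]; ring
    · have h0 : α j = 0 := by omega
      rw [if_neg h]
      simp [h0, mul_assoc]
  have hLI : ∫ x, ‖L x‖ ^ 2 = ∑ α ∈ s with 1 ≤ α j, ‖c α * (Real.sqrt (α j / 2) : ℂ)‖ ^ 2 := by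
    refine hb_parseval _ (fun α => c α * (Real.sqrt (α j / 2) : ℂ))
      (fun α => Function.update α j (α j - 1)) ?_
    intro α hα β hβ hab
    simp at hα hβ
    funext i
    have := congrFun hab i
    by_cases hi : i = j
    · subst hi; simp at this; omega
    · simpa [hi] using this
  have hRI : ∫ x, ‖R x‖ ^ 2 = ∑ α ∈ s, ‖c α * (Real.sqrt ((α j + 1) / 2) : ℂ)‖ ^ 2 := by
    refine hb_parseval _ (fun α => c α * (Real.sqrt ((α j + 1) / 2) : ℂ))
      (fun α => Function.update α j (α j + 1)) ?_
    intro α hα β hβ hab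
    funext i
    have := congrFun hab i
    by_cases hi : i = j
    · subst hi; simpa using this
    · simpa [hi] using this
  have hFI := hb_parseval s c (fun α => α) (fun α _ β _ h => h)
  constructor
  · rw [hD]
    refine Submodule.sub_mem _ ?_ ?_
    · have : L = ∑ α ∈ s with 1 ≤ α j, (c α * (Real.sqrt (α j / 2) : ℂ)) •
          hermitePhi (Function.update α j (α j - 1)) := by
        funext x; simp [hL]
      rw [this]
      refine Submodule.sum_mem _ fun α hα => Submodule.smul_mem _ _ (hb_phi_mem _ ?_)
      have h1 := hupd α (α j - 1)
      have h2 := hs α (Finset.mem_filter.mp hα).1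
      omega
    · have : R = ∑ α ∈ s, (c α * (Real.sqrt ((α j + 1) / 2) : ℂ)) •
          hermitePhi (Function.update α j (α j + 1)) := by
        funext x; simp [hR]
      rw [this]
      refine Submodule.sum_mem _ fun α hα => Submodule.smul_mem _ _ (hb_phi_mem _ ?_)
      have h1 := hupd α (α j + 1)
      have h2 := hs α hα
      omega
  · have hiL : Integrable (fun x => ‖L x‖ ^ 2) := hb_sum_integrable _ _ _
    have hiR : Integrable (fun x => ‖R x‖ ^ 2) := hb_sum_integrable _ _ _
    have h1 : ∫ x, ‖partialDerivE j (fun x => ∑ α ∈ s, c α * hermitePhi α x) x‖ ^ 2 ≤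
        ∫ x, (2 * ‖L x‖ ^ 2 + 2 * ‖R x‖ ^ 2) := by
      rw [hD]
      refine integral_mono_of_nonneg (Filter.Eventually.of_forall fun x => by positivity)
        ((hiL.const_mul 2).add (hiR.const_mul 2)) (Filter.Eventually.of_forall fun x => ?_)
      simp only [Pi.sub_apply]
      have h := norm_sub_le (L x) (R x)
      have h0 := norm_nonneg (L x - R x)
      nlinarith [sq_nonneg (‖L x‖ - ‖R x‖)]
    refine h1.trans ?_
    rw [integral_add (hiL.const_mul 2) (hiR.const_mul 2), integral_const_mul, integral_const_mul,
      hLI, hRI, hFI, Finset.mul_sum, Finset.mul_sum, Finset.mul_sum]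
    have h2 : ∑ α ∈ s with 1 ≤ α j, 2 * ‖c α * (Real.sqrt (α j / 2) : ℂ)‖ ^ 2 ≤
        ∑ α ∈ s, 2 * ‖c α * (Real.sqrt (α j / 2) : ℂ)‖ ^ 2 :=
      Finset.sum_le_sum_of_subset_of_nonneg (Finset.filter_subset _ _)
        (fun α _ _ => by positivity)
    refine (add_le_add_left h2 _).trans ?_
    rw [← Finset.sum_add_distrib]
    refine Finset.sum_le_sum fun α hα => ?_
    have h3 := hle α hα
    have e1 : ‖c α * (Real.sqrt (α j / 2) : ℂ)‖ ^ 2 = ‖c α‖ ^ 2 * (α j / 2) := by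
      rw [norm_mul, mul_pow, Complex.norm_real, Real.norm_eq_abs, sq_abs,
        Real.sq_sqrt (by positivity)]
    have e2 : ‖c α * (Real.sqrt ((α j + 1) / 2) : ℂ)‖ ^ 2 = ‖c α‖ ^ 2 * ((α j + 1) / 2) := by
      rw [norm_mul, mul_pow, Complex.norm_real, Real.norm_eq_abs, sq_abs,
        Real.sq_sqrt (by positivity)]
    rw [e1, e2]
    nlinarith [sq_nonneg ‖c α‖]

lemma hb_iter {n N : ℕ} {f g : EuclideanSpace ℝ (Fin n) → ℂ} (j : Fin n) (m k : ℕ)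
    (hg : g ∈ hermiteSpan n (N + m) ∧ ∫ x, ‖g x‖ ^ 2 ≤
      (∏ i ∈ Finset.range m, (2 * ((N : ℝ) + i) + 2)) * ∫ x, ‖f x‖ ^ 2) :
    (partialDerivE j)^[k] g ∈ hermiteSpan n (N + (k + m)) ∧
      ∫ x, ‖(partialDerivE j)^[k] g x‖ ^ 2 ≤
      (∏ i ∈ Finset.range (k + m), (2 * ((N : ℝ) + i) + 2)) * ∫ x, ‖f x‖ ^ 2 := by
  induction k with
  | zero => simpa using hg
  | succ k ih =>
    rw [Function.iterate_succ_apply']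
    have h := hb_step ih.1 j
    have e : k + 1 + m = (k + m) + 1 := by ring
    rw [e]
    refine ⟨h.1, h.2.trans ?_⟩
    rw [Finset.prod_range_succ]
    have := mul_le_mul_of_nonneg_left ih.2
      (show (0 : ℝ) ≤ 2 * ((N + (k + m) : ℕ) : ℝ) + 2 by positivity)
    refine this.trans (le_of_eq ?_)
    push_cast
    ring

lemma hb_fold {n N : ℕ} {f : EuclideanSpace ℝ (Fin n) → ℂ} (hf : f ∈ hermiteSpan n N)
    (β : Fin n → ℕ) (l : List (Fin n)) :
    l.foldr (fun j g => (partialDerivE j)^[β j] g) f ∈ hermiteSpan n (N + (l.map β).sum) ∧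
      ∫ x, ‖l.foldr (fun j g => (partialDerivE j)^[β j] g) f x‖ ^ 2 ≤
      (∏ i ∈ Finset.range (l.map β).sum, (2 * ((N : ℝ) + i) + 2)) * ∫ x, ‖f x‖ ^ 2 := by
  induction l with
  | nil => simpa using hf
  | cons j l ih =>
    simp only [List.foldr_cons, List.map_cons, List.sum_cons]
    exact hb_iter j _ _ ih

lemma hb_num (N m : ℕ) (δ : ℝ) (hδ : 0 < δ) :
    ∏ i ∈ Finset.range m, (2 * ((N : ℝ) + i) + 2) ≤
      (Real.exp (Real.exp 1 / (2 * δ ^ 2)) * (2 * δ) ^ m *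
        (Nat.factorial m : ℝ) * Real.exp (δ⁻¹ * Real.sqrt N)) ^ 2 := by
  have h1 : ∏ i ∈ Finset.range m, (2 * ((N : ℝ) + i) + 2) ≤ (2 * ((N : ℝ) + m)) ^ m := by
    calc _ ≤ ∏ i ∈ Finset.range m, (2 * ((N : ℝ) + m)) := by
          refine Finset.prod_le_prod (fun i _ => by positivity) fun i hi => ?_
          have : ((i + 1 : ℕ) : ℝ) ≤ m := by exact_mod_cast Finset.mem_range.mp hi
          push_cast at this
          linarith
      _ = _ := by simp
  refine h1.trans ?_
  have hE1 : 1 ≤ Real.exp (Real.exp 1 / (2 * δ ^ 2)) := Real.one_le_exp (by positivity)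
  have hE2 : 1 ≤ Real.exp (δ⁻¹ * Real.sqrt N) := Real.one_le_exp (by positivity)
  rcases le_total m N with h | h
  · have hc : (m : ℝ) ≤ N := by exact_mod_cast h
    have h2 : (2 * ((N : ℝ) + m)) ^ m ≤ (2 ^ m * (Real.sqrt N) ^ m) ^ 2 := by
      rw [← mul_pow, ← pow_mul, mul_comm m 2, pow_mul, mul_pow 2 (Real.sqrt N) 2,
        Real.sq_sqrt (by positivity)]
      exact pow_le_pow_left₀ (by positivity) (by linarith) m
    refine h2.trans ?_
    have h3 := Real.pow_div_factorial_le_exp (x := δ⁻¹ * Real.sqrt N) (by positivity) m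
    rw [div_le_iff₀ (by positivity), mul_pow, inv_pow] at h3
    have h4 : (Real.sqrt N) ^ m ≤ δ ^ m * (Real.exp (δ⁻¹ * Real.sqrt N) * m.factorial) := by
      calc (Real.sqrt N) ^ m = δ ^ m * ((δ ^ m)⁻¹ * (Real.sqrt N) ^ m) := by
            rw [← mul_assoc, mul_inv_cancel₀ (by positivity), one_mul]
        _ ≤ _ := by gcongr
    refine pow_le_pow_left₀ (by positivity) ?_ 2
    calc 2 ^ m * (Real.sqrt N) ^ m
        ≤ 2 ^ m * (δ ^ m * (Real.exp (δ⁻¹ * Real.sqrt N) * m.factorial)) := by gcongr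
      _ = 1 * (2 * δ) ^ m * (Nat.factorial m : ℝ) * Real.exp (δ⁻¹ * Real.sqrt N) := by
          rw [mul_pow]; ring
      _ ≤ _ := by gcongr
  · have hc : (N : ℝ) ≤ m := by exact_mod_cast h
    rcases Nat.eq_zero_or_pos m with h0 | hm
    · subst h0
      simp
      nlinarith
    have hmpos : (0 : ℝ) < m := by exact_mod_cast hm
    have h2 : (2 * ((N : ℝ) + m)) ^ m ≤ (4 * (m : ℝ)) ^ m := by
      exact pow_le_pow_left₀ (by positivity) (by linarith) m
    refine h2.trans ?_
    have h3 := Real.pow_div_factorial_le_exp (x := (m : ℝ)) (by positivity) m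
    rw [div_le_iff₀ (by positivity)] at h3
    set t : ℝ := Real.exp 1 / (δ ^ 2 * m) with ht
    have ht0 : 0 < t := by positivity
    have h4 : Real.exp 1 * t ≤ Real.exp t := by
      have := Real.add_one_le_exp (t - 1)
      have e : Real.exp t = Real.exp 1 * Real.exp (t - 1) := by
        rw [← Real.exp_add]; congr 1; ring
      rw [e]
      gcongr
      linarith
    have h5 : (Real.exp 1 * t) ^ m ≤ Real.exp (Real.exp 1 / (2 * δ ^ 2)) ^ 2 := by
      calc _ ≤ (Real.exp t) ^ m := by gcongr
        _ = _ := by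
          rw [← Real.exp_nat_mul, ← Real.exp_nat_mul]
          congr 1
          rw [ht]
          push_cast
          field_simp
    have h6 : (4 * (m : ℝ)) ^ m = (Real.exp 1 * t) ^ m * ((2 * δ) ^ m) ^ 2 *
        ((m : ℝ) ^ m / Real.exp m) ^ 2 := by
      have e : Real.exp (m : ℝ) = Real.exp 1 ^ m := by rw [← Real.exp_nat_mul]; simp
      rw [e, ← div_pow, ← pow_mul, ← pow_mul, mul_comm m 2, pow_mul, pow_mul, ← mul_pow, ← mul_pow]
      congr 1
      rw [ht]
      have := Real.exp_pos 1
      field_simp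
      norm_num
    have h7 : (m : ℝ) ^ m / Real.exp m ≤ m.factorial := by
      rw [div_le_iff₀ (Real.exp_pos _)]; linarith
    rw [h6]
    calc _ ≤ Real.exp (Real.exp 1 / (2 * δ ^ 2)) ^ 2 * ((2 * δ) ^ m) ^ 2 *
          (m.factorial : ℝ) ^ 2 * 1 ^ 2 := by
          rw [one_pow, mul_one]
          gcongr
      _ ≤ Real.exp (Real.exp 1 / (2 * δ ^ 2)) ^ 2 * ((2 * δ) ^ m) ^ 2 *
          (m.factorial : ℝ) ^ 2 * Real.exp (δ⁻¹ * Real.sqrt N) ^ 2 := by gcongr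
      _ = _ := by ring

/-- **Bernstein-type estimates for finite combinations of Hermite functions.** For every
`N ∈ ℕ`, `f ∈ E_N`, `0 < δ ≤ 1` and multi-index `β ∈ ℕⁿ`,
`‖∂_x^β f‖_{L²(ℝⁿ)} ≤ e^{e/(2δ²)} (2δ)^{|β|} |β|! e^{δ⁻¹ √N} ‖f‖_{L²(ℝⁿ)}`. -/
theorem hermite_bernstein (n : ℕ) (hn : 1 ≤ n) (N : ℕ)
    (f : EuclideanSpace ℝ (Fin n) → ℂ) (hf : f ∈ hermiteSpan n N)
    (δ : ℝ) (hδ0 : 0 < δ) (hδ1 : δ ≤ 1) (β : Fin n → ℕ) :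
    Real.sqrt (∫ x, ‖multiDerivE β f x‖ ^ 2) ≤
      Real.exp (Real.exp 1 / (2 * δ ^ 2)) * (2 * δ) ^ (∑ j, β j) *
        (Nat.factorial (∑ j, β j) : ℝ) * Real.exp (δ⁻¹ * Real.sqrt N) *
        Real.sqrt (∫ x, ‖f x‖ ^ 2) := by
  have h := (hb_fold hf β (List.finRange n)).2
  have hs : ((List.finRange n).map β).sum = ∑ j, β j := (Fin.sum_univ_def β).symm
  rw [hs] at h
  have h2 := hb_num N (∑ j, β j) δ hδ0
  have hI : 0 ≤ ∫ x, ‖f x‖ ^ 2 := integral_nonneg fun x => by positivity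
  rw [Real.sqrt_le_left (by positivity), mul_pow, Real.sq_sqrt hI]
  exact h.trans (mul_le_mul_of_nonneg_right h2 hI)
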